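/- W*AP(ℝ^d) satisfies the ergodicity criterion: for every f ∈ W*AP(ℝ^d) (so f = g + h with g ∈ AP(ℝ^d), h ∈ N(ℝ^d)), the mean value M(f) = lim_{R→∞} (1/|B(0,R)|) ∫_{B(0,R)} f(y) dy exists, and moreover lim_{t→∞} limsup_{L→∞} (1/|B(0,L)|) ∫_{B(0,L)} | (1/|B(0,t)|) ∫_{B(0,t)} f(x+y) dx − M(f) |² dy = 0. -/

import Mathlib

open MeasureTheory Filter Topology

/-- The translate of a bounded continuous function `f` by `l`: the function `x ↦ f (x + l)`. -/
noncomputable def translateBCF {d : ℕ}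
    (f : BoundedContinuousFunction (EuclideanSpace ℝ (Fin d)) ℝ)
    (l : EuclideanSpace ℝ (Fin d)) :
    BoundedContinuousFunction (EuclideanSpace ℝ (Fin d)) ℝ :=
  f.compContinuous ⟨fun x => x + l, by continuity⟩

/-- `f` is almost periodic in the Bochner sense: `f` is (bounded and) uniformly continuous and
its set of translates is totally bounded in the sup norm. -/
def IsAP {d : ℕ} (f : BoundedContinuousFunction (EuclideanSpace ℝ (Fin d)) ℝ) : Prop :=
  UniformContinuous ⇑f ∧
  TotallyBounded {g : BoundedContinuousFunction (EuclideanSpace ℝ (Fin d)) ℝ |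
    ∃ l : EuclideanSpace ℝ (Fin d), g = translateBCF f l}

/-- `f` belongs to `N(ℝ^d)`: it is (bounded and) uniformly continuous and the averages of `|f|`
over balls `B(0,R)` tend to `0` as `R → ∞`. -/
def IsVanishingMean {d : ℕ} (f : BoundedContinuousFunction (EuclideanSpace ℝ (Fin d)) ℝ) : Prop :=
  UniformContinuous ⇑f ∧
  Tendsto (fun R : ℝ =>
    ⨍ y in Metric.ball (0 : EuclideanSpace ℝ (Fin d)) R, |f y|) atTop (𝓝 0)

/-- The normalized Lebesgue measure on the ball `B(0,R)`. -/
noncomputable def ballAverageMeasure (d : ℕ) (R : ℝ) : Measure (EuclideanSpace ℝ (Fin d)) :=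
  (volume.restrict (Metric.ball (0 : EuclideanSpace ℝ (Fin d)) R) Set.univ)⁻¹ •
    volume.restrict (Metric.ball (0 : EuclideanSpace ℝ (Fin d)) R)

lemma setAverage_ball_eq {d : ℕ} (R : ℝ) (u : EuclideanSpace ℝ (Fin d) → ℝ) :
    ⨍ x in Metric.ball (0 : EuclideanSpace ℝ (Fin d)) R, u x =
      ∫ x, u x ∂ballAverageMeasure d R := rfl

lemma isProbabilityMeasure_ballAverageMeasure (d : ℕ) {R : ℝ} (hR : 0 < R) :
    IsProbabilityMeasure (ballAverageMeasure d R) := by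
  have : NeZero (volume.restrict (Metric.ball (0 : EuclideanSpace ℝ (Fin d)) R)) :=
    ⟨by simpa [Measure.restrict_eq_zero] using
      (Metric.measure_ball_pos volume (0 : EuclideanSpace ℝ (Fin d)) hR).ne'⟩
  have : IsFiniteMeasure (volume.restrict (Metric.ball (0 : EuclideanSpace ℝ (Fin d)) R)) :=
    ⟨by simpa using measure_ball_lt_top⟩
  unfold ballAverageMeasure
  infer_instance

lemma integrable_of_continuous_of_abs_le {X : Type*} [TopologicalSpace X] [MeasurableSpace X]
    [OpensMeasurableSpace X] {μ : Measure X} [IsFiniteMeasure μ] {u : X → ℝ} {C : ℝ}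
    (hu : Continuous u) (hC : ∀ x, |u x| ≤ C) : Integrable u μ :=
  Integrable.of_bound hu.measurable.aestronglyMeasurable C (Eventually.of_forall hC)

lemma abs_integral_le_of_abs_le {X : Type*} [MeasurableSpace X]
    {μ : Measure X} [IsProbabilityMeasure μ] {u : X → ℝ} {C : ℝ}
    (hC : ∀ x, |u x| ≤ C) : |∫ x, u x ∂μ| ≤ C := by
  simpa using norm_integral_le_of_norm_le_const (μ := μ) (f := u) (Eventually.of_forall hC)

lemma continuous_integral_add {d : ℕ} {μ : Measure (EuclideanSpace ℝ (Fin d))}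
    [IsProbabilityMeasure μ] {u : EuclideanSpace ℝ (Fin d) → ℝ} {C : ℝ}
    (hu : Continuous u) (hC : ∀ x, |u x| ≤ C) : Continuous fun y => ∫ x, u (x + y) ∂μ := by
  refine continuous_of_dominated (bound := fun _ => C) ?_ ?_ (integrable_const C) ?_
  · intro y
    exact (hu.comp (continuous_add_const y)).measurable.aestronglyMeasurable
  · exact fun y => Eventually.of_forall fun x => hC (x + y)
  · exact Eventually.of_forall fun x => hu.comp (continuous_const_add x)

lemma integral_integral_add_comm {d : ℕ} {μ ν : Measure (EuclideanSpace ℝ (Fin d))}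
    [IsProbabilityMeasure μ] [IsProbabilityMeasure ν] {u : EuclideanSpace ℝ (Fin d) → ℝ} {C : ℝ}
    (hu : Continuous u) (hC : ∀ x, |u x| ≤ C) :
    ∫ y, ∫ x, u (x + y) ∂μ ∂ν = ∫ y, ∫ x, u (x + y) ∂ν ∂μ := by
  rw [integral_integral_swap]
  · simp_rw [add_comm]
  · exact integrable_of_continuous_of_abs_le (hu.comp (continuous_snd.add continuous_fst))
      fun p => hC _

/-- Translating the ball of averaging changes the average of a bounded function by at most twice
the bound times the relative volume of the enclosing annulus. -/
lemma abs_integral_add_sub_le {d : ℕ} {u : EuclideanSpace ℝ (Fin d) → ℝ} {C R r : ℝ}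
    (hu : Continuous u) (hC : ∀ x, |u x| ≤ C) (hR : 0 < R)
    {y : EuclideanSpace ℝ (Fin d)} (hy : ‖y‖ ≤ r) :
    |∫ x, u (x + y) ∂ballAverageMeasure d R - ∫ x, u x ∂ballAverageMeasure d R| ≤
      2 * C * (((R + r) / R) ^ d - 1) := by
  have hr : 0 ≤ r := (norm_nonneg y).trans hy
  have hC0 : 0 ≤ C := (abs_nonneg _).trans (hC 0)
  set V : ℝ := volume.real (Metric.ball (0 : EuclideanSpace ℝ (Fin d)) 1) with hV
  have hVpos : 0 < V := ENNReal.toReal_pos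
    (Metric.measure_ball_pos _ _ one_pos).ne' measure_ball_lt_top.ne
  have hvol : ∀ (z : EuclideanSpace ℝ (Fin d)) (s : ℝ), 0 < s →
      volume.real (Metric.ball z s) = s ^ d * V := by
    intro z s hs
    rw [measureReal_def, Measure.addHaar_ball_of_pos _ _ hs, finrank_euclideanSpace_fin,
      ENNReal.toReal_mul, ENNReal.toReal_ofReal (by positivity), hV, measureReal_def]
  have hint : ∀ (z : EuclideanSpace ℝ (Fin d)) (s : ℝ), IntegrableOn u (Metric.ball z s) := by
    intro z s
    have : IsFiniteMeasure (volume.restrict (Metric.ball z s)) :=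
      ⟨by simpa using measure_ball_lt_top⟩
    exact integrable_of_continuous_of_abs_le hu hC
  have hshift : ∫ x in Metric.ball 0 R, u (x + y) = ∫ x in Metric.ball y R, u x := by
    rw [← (measurePreserving_add_right volume y).setIntegral_preimage_emb
      (measurableEmbedding_addRight y) u (Metric.ball y R)]
    congr 2
    ext x
    simp
  have hdiff : ∀ z : EuclideanSpace ℝ (Fin d), ‖z‖ ≤ r →
      |(∫ x in Metric.ball 0 (R + r), u x) - ∫ x in Metric.ball z R, u x| ≤
        C * ((R + r) ^ d * V - R ^ d * V) := by
    intro z hz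
    have hsub : Metric.ball z R ⊆ Metric.ball 0 (R + r) :=
      Metric.ball_subset_ball' (by rw [dist_zero_right]; linarith)
    rw [← setIntegral_sdiff measurableSet_ball (hint _ _) hsub, ← hvol 0 _ (by positivity),
      ← hvol z R hR, ← measureReal_sdiff hsub measurableSet_ball]
    exact norm_setIntegral_le_of_norm_le_const (f := u)
      ((measure_mono Set.sdiff_subset).trans_lt measure_ball_lt_top) fun x _ => hC x
  have h0 := hdiff 0 (by simpa using hr)
  have h1 := hdiff y hy
  rw [← setAverage_ball_eq, ← setAverage_ball_eq, setAverage_eq, setAverage_eq, hshift,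
    hvol 0 R hR, smul_eq_mul, smul_eq_mul, ← mul_sub, abs_mul, abs_of_pos (by positivity)]
  have hRd : 0 < R ^ d * V := by positivity
  have key : |(∫ x in Metric.ball y R, u x) - ∫ x in Metric.ball 0 R, u x| ≤
      2 * (C * ((R + r) ^ d * V - R ^ d * V)) := by
    rw [abs_le] at h0 h1 ⊢
    constructor <;> linarith [h0.1, h0.2, h1.1, h1.2]
  calc _ ≤ (R ^ d * V)⁻¹ * (2 * (C * ((R + r) ^ d * V - R ^ d * V))) := by gcongr
    _ = _ := by rw [div_pow]; field_simp

lemma tendsto_annulus_ratio (d : ℕ) (C r : ℝ) :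
    Tendsto (fun R : ℝ => 2 * C * (((R + r) / R) ^ d - 1)) atTop (𝓝 0) := by
  have h1 : Tendsto (fun R : ℝ => 1 + r / R) atTop (𝓝 (1 + 0)) :=
    tendsto_const_nhds.add (tendsto_const_nhds.div_atTop tendsto_id)
  have h2 : Tendsto (fun R : ℝ => 2 * C * ((1 + r / R) ^ d - 1)) atTop
      (𝓝 (2 * C * ((1 + 0) ^ d - 1))) := ((h1.pow d).sub_const 1).const_mul _
  simp only [add_zero, one_pow, sub_self, mul_zero] at h2
  refine h2.congr' ?_
  filter_upwards [eventually_gt_atTop 0] with R hR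
  rw [add_div, div_self hR.ne']

lemma abs_apply_le_norm {d : ℕ} (u : BoundedContinuousFunction (EuclideanSpace ℝ (Fin d)) ℝ)
    (x : EuclideanSpace ℝ (Fin d)) : |u x| ≤ ‖u‖ := u.norm_coe_le_norm x

/-- The ball averages of an almost periodic function become independent of the center. -/
lemma IsAP.eventually_abs_integral_add_sub_le {d : ℕ}
    {g : BoundedContinuousFunction (EuclideanSpace ℝ (Fin d)) ℝ} (hg : IsAP g)
    {ε : ℝ} (hε : 0 < ε) :
    ∀ᶠ R : ℝ in atTop, ∀ y : EuclideanSpace ℝ (Fin d),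
      |∫ x, g (x + y) ∂ballAverageMeasure d R - ∫ x, g x ∂ballAverageMeasure d R| ≤ ε := by
  obtain ⟨t, htsub, htfin, ht⟩ := Metric.finite_approx_of_totallyBounded hg.2 (ε / 2) (half_pos hε)
  have htl : ∀ p, ∃ l, p ∈ t → p = translateBCF g l := fun p => by
    by_cases hp : p ∈ t
    · exact (htsub hp).imp fun _ h _ => h
    · exact ⟨0, fun h => absurd h hp⟩
  choose l hl using htl
  obtain ⟨r, hr⟩ := (htfin.image l).isBounded.exists_norm_le
  filter_upwards [eventually_gt_atTop 0,
    (tendsto_annulus_ratio d ‖g‖ r).eventually (gt_mem_nhds (half_pos hε))] with R hR hsmall y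
  have := isProbabilityMeasure_ballAverageMeasure d hR
  obtain ⟨p, hp, hyp⟩ := Set.mem_iUnion₂.1 (ht ⟨y, rfl⟩)
  have hlp : ‖l p‖ ≤ r := hr _ (Set.mem_image_of_mem l hp)
  have h1 := abs_integral_add_sub_le g.continuous (abs_apply_le_norm g) hR hlp
  have hi : ∀ z, Integrable (fun x => g (x + z)) (ballAverageMeasure d R) := fun z =>
    integrable_of_continuous_of_abs_le (g.continuous.comp (continuous_add_const z))
      fun x => abs_apply_le_norm g _
  have h2 : |∫ x, g (x + y) ∂ballAverageMeasure d R -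
      ∫ x, g (x + l p) ∂ballAverageMeasure d R| ≤ ε / 2 := by
    rw [← integral_sub (hi y) (hi (l p))]
    refine abs_integral_le_of_abs_le fun x => ?_
    have h3 := (BoundedContinuousFunction.dist_coe_le_dist (f := translateBCF g y) (g := p)
      x).trans (Metric.mem_ball.1 hyp).le
    rw [hl p hp] at h3
    exact h3
  calc _ ≤ _ := abs_sub_le _ (∫ x, g (x + l p) ∂ballAverageMeasure d R) _
    _ ≤ ε := by linarith

/-- The ball averages of an almost periodic function converge, uniformly in the center. -/
lemma IsAP.exists_mean {d : ℕ}
    {g : BoundedContinuousFunction (EuclideanSpace ℝ (Fin d)) ℝ} (hg : IsAP g) :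
    ∃ c : ℝ, ∀ ε > 0, ∀ᶠ R : ℝ in atTop, ∀ y : EuclideanSpace ℝ (Fin d),
      |∫ x, g (x + y) ∂ballAverageMeasure d R - c| ≤ ε := by
  have hcomm : ∀ {R S ε : ℝ}, 0 < R → 0 < S →
      (∀ y, |∫ x, g (x + y) ∂ballAverageMeasure d R - ∫ x, g x ∂ballAverageMeasure d R| ≤ ε) →
      |∫ y, ∫ x, g (x + y) ∂ballAverageMeasure d R ∂ballAverageMeasure d S -
        ∫ x, g x ∂ballAverageMeasure d R| ≤ ε := by
    intro R S ε hR hS h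
    have := isProbabilityMeasure_ballAverageMeasure d hR
    have := isProbabilityMeasure_ballAverageMeasure d hS
    have hi : Integrable (fun y => ∫ x, g (x + y) ∂ballAverageMeasure d R)
        (ballAverageMeasure d S) :=
      integrable_of_continuous_of_abs_le
        (continuous_integral_add g.continuous (abs_apply_le_norm g))
        fun y => abs_integral_le_of_abs_le fun x => abs_apply_le_norm g _
    have := abs_integral_le_of_abs_le (μ := ballAverageMeasure d S) h
    rwa [integral_sub hi (integrable_const _), integral_const, probReal_univ, one_smul] at this
  have hcauchy : Cauchy (map (fun R : ℝ => ∫ x, g x ∂ballAverageMeasure d R) atTop) := by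
    rw [Metric.cauchy_iff]
    refine ⟨inferInstance, fun ε hε => ?_⟩
    have hev := (eventually_gt_atTop (0 : ℝ)).and
      (hg.eventually_abs_integral_add_sub_le (show 0 < ε / 3 by positivity))
    refine ⟨_, image_mem_map hev, ?_⟩
    rintro _ ⟨R, ⟨hR, hRy⟩, rfl⟩ _ ⟨S, ⟨hS, hSy⟩, rfl⟩
    have := isProbabilityMeasure_ballAverageMeasure d hR
    have := isProbabilityMeasure_ballAverageMeasure d hS
    have h1 := hcomm hR hS hRy
    have h2 := hcomm hS hR hSy
    rw [integral_integral_add_comm g.continuous (abs_apply_le_norm g)] at h2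
    rw [abs_le] at h1 h2
    rw [Real.dist_eq, abs_lt]
    constructor <;> linarith [h1.1, h1.2, h2.1, h2.2]
  obtain ⟨c, hc⟩ := CompleteSpace.complete hcauchy
  refine ⟨c, fun ε hε => ?_⟩
  filter_upwards [hg.eventually_abs_integral_add_sub_le (half_pos hε),
    (show Tendsto _ atTop (𝓝 c) from hc).eventually (Metric.ball_mem_nhds c (half_pos hε))]
    with R h1 h2 y
  have h3 : |∫ x, g x ∂ballAverageMeasure d R - c| < ε / 2 := h2
  calc _ ≤ _ := abs_sub_le _ (∫ x, g x ∂ballAverageMeasure d R) _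
    _ ≤ ε := by linarith [h1 y]

/-- For `h` of vanishing mean modulus, the iterated averages of `|h|` vanish in the limit. -/
lemma IsVanishingMean.tendsto_integral_integral {d : ℕ}
    {h : BoundedContinuousFunction (EuclideanSpace ℝ (Fin d)) ℝ} (hh : IsVanishingMean h)
    {t : ℝ} (ht : 0 < t) :
    Tendsto (fun L : ℝ => ∫ y, ∫ x, |h (x + y)| ∂ballAverageMeasure d t ∂ballAverageMeasure d L)
      atTop (𝓝 0) := by
  have hcont : Continuous fun x => |h x| := h.continuous.abs
  have hbd : ∀ x, |(|h x|)| ≤ ‖h‖ := fun x => by rw [abs_abs]; exact abs_apply_le_norm h x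
  have := isProbabilityMeasure_ballAverageMeasure d ht
  have hpt : ∀ y, Tendsto (fun L : ℝ => ∫ x, |h (x + y)| ∂ballAverageMeasure d L) atTop (𝓝 0) := by
    intro y
    have h1 : Tendsto (fun L : ℝ => ∫ x, |h (x + y)| ∂ballAverageMeasure d L -
        ∫ x, |h x| ∂ballAverageMeasure d L) atTop (𝓝 0) := by
      refine squeeze_zero_norm' ?_ (tendsto_annulus_ratio d ‖h‖ ‖y‖)
      filter_upwards [eventually_gt_atTop 0] with L hL
      exact abs_integral_add_sub_le hcont hbd hL le_rfl
    have h2 := hh.2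
    simp only [setAverage_ball_eq] at h2
    simpa using h1.add h2
  have hlim : Tendsto
      (fun L : ℝ => ∫ y, ∫ x, |h (x + y)| ∂ballAverageMeasure d L ∂ballAverageMeasure d t)
      atTop (𝓝 (∫ _, (0 : ℝ) ∂ballAverageMeasure d t)) := by
    refine tendsto_integral_filter_of_dominated_convergence (fun _ => ‖h‖) ?_ ?_
      (integrable_const _) (Eventually.of_forall hpt)
    · filter_upwards [eventually_gt_atTop 0] with L hL
      have := isProbabilityMeasure_ballAverageMeasure d hL
      exact (continuous_integral_add hcont hbd).measurable.aestronglyMeasurable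
    · filter_upwards [eventually_gt_atTop 0] with L hL
      have := isProbabilityMeasure_ballAverageMeasure d hL
      exact Eventually.of_forall fun y => abs_integral_le_of_abs_le fun x => hbd _
  rw [integral_zero] at hlim
  refine hlim.congr' ?_
  filter_upwards [eventually_gt_atTop 0] with L hL
  have := isProbabilityMeasure_ballAverageMeasure d hL
  exact integral_integral_add_comm hcont hbd

/-- `W*AP(ℝ^d)` satisfies the ergodicity criterion: every `f = g + h` with `g ∈ AP(ℝ^d)` and
`h ∈ N(ℝ^d)` possesses a mean value `c`, and the quadratic means of the deviations of the
sliding ball averages of `f` from `c` tend to `0`. -/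
theorem wstarap_ergodicity_criterion {d : ℕ}
    (g h f : BoundedContinuousFunction (EuclideanSpace ℝ (Fin d)) ℝ)
    (hg : IsAP g) (hh : IsVanishingMean h) (hf : f = g + h) :
    ∃ c : ℝ,
      Tendsto (fun R : ℝ =>
          ⨍ y in Metric.ball (0 : EuclideanSpace ℝ (Fin d)) R, f y) atTop (𝓝 c) ∧
      Tendsto (fun t : ℝ =>
          limsup (fun L : ℝ =>
              ⨍ y in Metric.ball (0 : EuclideanSpace ℝ (Fin d)) L,
                |(⨍ x in Metric.ball (0 : EuclideanSpace ℝ (Fin d)) t, f (x + y)) - c| ^ 2)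
            atTop)
        atTop (𝓝 0) := by
  subst hf
  obtain ⟨c, hc⟩ := hg.exists_mean
  have hig : ∀ {R : ℝ}, 0 < R → ∀ y, Integrable (fun x => g (x + y)) (ballAverageMeasure d R) := by
    intro R hR y
    have := isProbabilityMeasure_ballAverageMeasure d hR
    exact integrable_of_continuous_of_abs_le (g.continuous.comp (continuous_add_const y))
      fun x => abs_apply_le_norm g _
  have hih : ∀ {R : ℝ}, 0 < R → ∀ y, Integrable (fun x => h (x + y)) (ballAverageMeasure d R) := by
    intro R hR y
    have := isProbabilityMeasure_ballAverageMeasure d hR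
    exact integrable_of_continuous_of_abs_le (h.continuous.comp (continuous_add_const y))
      fun x => abs_apply_le_norm h _
  simp only [setAverage_ball_eq, BoundedContinuousFunction.coe_add, Pi.add_apply]
  refine ⟨c, ?_, ?_⟩
  · have h1 : Tendsto (fun R : ℝ => ∫ x, g x ∂ballAverageMeasure d R) atTop (𝓝 c) := by
      rw [Metric.tendsto_nhds]
      intro ε hε
      filter_upwards [hc (ε / 2) (half_pos hε)] with R hR
      have := hR 0
      simp only [add_zero] at this
      rw [Real.dist_eq]
      linarith
    have h2 : Tendsto (fun R : ℝ => ∫ x, h x ∂ballAverageMeasure d R) atTop (𝓝 0) :=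
      squeeze_zero_norm (fun R => norm_integral_le_integral_norm _) hh.2
    have h3 := h1.add h2
    rw [add_zero] at h3
    refine h3.congr' ?_
    filter_upwards [eventually_gt_atTop 0] with R hR
    have e1 := hig hR 0
    have e2 := hih hR 0
    simp only [add_zero] at e1 e2
    exact (integral_add e1 e2).symm
  · rw [Metric.tendsto_nhds]
    intro ε hε
    have hδ : 0 < √(ε / 8) := Real.sqrt_pos.2 (by positivity)
    filter_upwards [eventually_gt_atTop 0, hc _ hδ] with t ht hct
    have := isProbabilityMeasure_ballAverageMeasure d ht
    have hpt : ∀ y, |(∫ x, (g (x + y) + h (x + y)) ∂ballAverageMeasure d t) - c| ^ 2 ≤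
        ε / 4 + 2 * ‖h‖ * ∫ x, |h (x + y)| ∂ballAverageMeasure d t := by
      intro y
      rw [integral_add (hig ht y) (hih ht y), sq_abs]
      set a := ∫ x, g (x + y) ∂ballAverageMeasure d t
      set b := ∫ x, h (x + y) ∂ballAverageMeasure d t
      have ha : (a - c) ^ 2 ≤ ε / 8 := by
        rw [← sq_abs, ← Real.sq_sqrt (show 0 ≤ ε / 8 by positivity)]
        exact pow_le_pow_left₀ (abs_nonneg _) (hct y) 2
      have hb1 : |b| ≤ ‖h‖ := abs_integral_le_of_abs_le fun x => abs_apply_le_norm h _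
      have hb2 : |b| ≤ ∫ x, |h (x + y)| ∂ballAverageMeasure d t :=
        abs_integral_le_integral_abs
      have hb : b ^ 2 ≤ ‖h‖ * ∫ x, |h (x + y)| ∂ballAverageMeasure d t := by
        rw [← sq_abs, sq]
        exact mul_le_mul hb1 hb2 (abs_nonneg _) (norm_nonneg _)
      nlinarith [sq_nonneg (a - c - b)]
    have hcontf : Continuous fun x => g x + h x := g.continuous.add h.continuous
    have hbdf : ∀ x, |g x + h x| ≤ ‖g‖ + ‖h‖ := fun x =>
      (abs_add_le _ _).trans (add_le_add (abs_apply_le_norm g x) (abs_apply_le_norm h x))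
    have hbdh : ∀ x, |(|h x|)| ≤ ‖h‖ := fun x => by rw [abs_abs]; exact abs_apply_le_norm h x
    have hev : ∀ᶠ L : ℝ in atTop, ∫ y, |(∫ x, (g (x + y) + h (x + y)) ∂ballAverageMeasure d t) - c|
        ^ 2 ∂ballAverageMeasure d L ≤ ε / 2 := by
      have hlim := (hh.tendsto_integral_integral ht).const_mul (2 * ‖h‖)
      rw [mul_zero] at hlim
      filter_upwards [eventually_gt_atTop 0,
        hlim.eventually (gt_mem_nhds (show 0 < ε / 4 by positivity))] with L hL hsmall
      have := isProbabilityMeasure_ballAverageMeasure d hL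
      have hI : Integrable (fun y => ∫ x, |h (x + y)| ∂ballAverageMeasure d t)
          (ballAverageMeasure d L) :=
        integrable_of_continuous_of_abs_le (continuous_integral_add h.continuous.abs hbdh)
          fun y => abs_integral_le_of_abs_le fun x => hbdh _
      calc _ ≤ ∫ y, (ε / 4 + 2 * ‖h‖ * ∫ x, |h (x + y)| ∂ballAverageMeasure d t)
            ∂ballAverageMeasure d L :=
            integral_mono_of_nonneg (Eventually.of_forall fun y => by positivity)
              ((integrable_const _).add (hI.const_mul _)) (Eventually.of_forall hpt)
        _ = ε / 4 + 2 * ‖h‖ * ∫ y, ∫ x, |h (x + y)| ∂ballAverageMeasure d t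
            ∂ballAverageMeasure d L := by
            rw [integral_add (integrable_const _) (hI.const_mul _), integral_const,
              probReal_univ, one_smul, integral_const_mul]
        _ ≤ ε / 2 := by linarith
    have hnonneg : ∀ L : ℝ, 0 ≤ ∫ y, |(∫ x, (g (x + y) + h (x + y)) ∂ballAverageMeasure d t) - c|
        ^ 2 ∂ballAverageMeasure d L := fun L => integral_nonneg fun y => by positivity
    have hupper := limsup_le_of_le
      (isCoboundedUnder_le_of_le atTop hnonneg) hev
    have hlower := le_limsup_of_frequently_le (Eventually.of_forall hnonneg).frequently
      (isBoundedUnder_of_eventually_le hev)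
    rw [Real.dist_eq, sub_zero, abs_of_nonneg hlower]
    linarith
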